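/- arXiv:2601.22568 — 6 statements merged into one kernel-verified Lean document; each statement's English description precedes it below -/
import Mathlib

section
/- Let q ≥ 1 and qs ≥ 1. Let ρ_1, …, ρ_n be positive semidefinite complex d × d matrices each of trace 1, let p_1, …, p_n be nonnegative reals with Σ_i p_i = 1, and set ρ = Σ_i p_i ρ_i. Then 1 − (Tr ρ^q)^s ≥ Σ_i p_i (1 − (Tr ρ_i^q)^s); that is, the function ρ ↦ 1 − (Tr ρ^q)^s is concave on density matrices. -/
open scoped ComplexOrder

/-- `Tr σ^r := Σ_i μ_i^r` where `μ_i` are the eigenvalues of the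
(Hermitian) matrix `σ`, with real powers. -/
noncomputable def trRpow {d : ℕ} (ρ : Matrix (Fin d) (Fin d) ℂ) (r : ℝ) : ℝ :=
  letI := Classical.dec ρ.IsHermitian
  if h : ρ.IsHermitian then ∑ i, h.eigenvalues i ^ r else 0

/-- For a Hermitian matrix, `trRpow` is the sum of the powers of its eigenvalues. -/
lemma trRpow_of_isHermitian {d : ℕ} {A : Matrix (Fin d) (Fin d) ℂ} (hA : A.IsHermitian) (r : ℝ) :
    trRpow A r = ∑ i, hA.eigenvalues i ^ r := by
  rw [trRpow, dif_pos hA]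

lemma trRpow_nonneg {d : ℕ} {A : Matrix (Fin d) (Fin d) ℂ} (hA : A.PosSemidef) (r : ℝ) :
    0 ≤ trRpow A r := by
  rw [trRpow_of_isHermitian hA.1]
  exact Finset.sum_nonneg fun i _ => Real.rpow_nonneg (hA.eigenvalues_nonneg i) r

lemma Matrix.IsHermitian.toEuclideanLin_eigenvectorBasis {d : ℕ} {A : Matrix (Fin d) (Fin d) ℂ}
    (hA : A.IsHermitian) (k : Fin d) :
    A.toEuclideanLin (hA.eigenvectorBasis k) =
      (hA.eigenvalues k : ℂ) • hA.eigenvectorBasis k := by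
  rw [Matrix.toLpLin_apply, hA.mulVec_eigenvectorBasis]
  ext i
  simp

/-- The quadratic form of a Hermitian matrix in terms of its spectral decomposition. -/
lemma Matrix.IsHermitian.re_inner_toEuclideanLin {d : ℕ} {A : Matrix (Fin d) (Fin d) ℂ}
    (hA : A.IsHermitian) (x : EuclideanSpace ℂ (Fin d)) :
    (inner ℂ x (A.toEuclideanLin x)).re =
      ∑ k, ‖inner ℂ (hA.eigenvectorBasis k) x‖ ^ 2 * hA.eigenvalues k := by
  rw [← hA.eigenvectorBasis.sum_inner_mul_inner, Complex.re_sum]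
  refine Finset.sum_congr rfl fun k _ => ?_
  have hsymm := Matrix.isSymmetric_toEuclideanLin_iff.mpr hA (hA.eigenvectorBasis k) x
  rw [← hsymm, hA.toEuclideanLin_eigenvectorBasis, inner_smul_left, Complex.conj_ofReal,
    ← inner_conj_symm x, mul_left_comm, Complex.conj_mul', mul_comm]
  norm_cast

lemma Matrix.IsHermitian.re_inner_eigenvectorBasis {d : ℕ} {A : Matrix (Fin d) (Fin d) ℂ}
    (hA : A.IsHermitian) (k : Fin d) :
    (inner ℂ (hA.eigenvectorBasis k) (A.toEuclideanLin (hA.eigenvectorBasis k))).re =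
      hA.eigenvalues k := by
  rw [hA.toEuclideanLin_eigenvectorBasis, inner_smul_right, inner_self_eq_norm_sq_to_K]
  simp

lemma Matrix.PosSemidef.re_inner_toEuclideanLin_nonneg {d : ℕ} {A : Matrix (Fin d) (Fin d) ℂ}
    (hA : A.PosSemidef) (x : EuclideanSpace ℂ (Fin d)) :
    0 ≤ (inner ℂ x (A.toEuclideanLin x)).re := by
  rw [hA.1.re_inner_toEuclideanLin]
  exact Finset.sum_nonneg fun k _ => mul_nonneg (sq_nonneg _) (hA.eigenvalues_nonneg k)

/-- **Peierls inequality** for powers: the diagonal of a positive semidefinite matrix in any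
orthonormal basis has at most the power sum of the eigenvalues. -/
lemma sum_re_inner_rpow_le_trRpow {d : ℕ} {A : Matrix (Fin d) (Fin d) ℂ} (hA : A.PosSemidef)
    (b : OrthonormalBasis (Fin d) ℂ (EuclideanSpace ℂ (Fin d))) {q : ℝ} (hq : 1 ≤ q) :
    ∑ j, (inner ℂ (b j) (A.toEuclideanLin (b j))).re ^ q ≤ trRpow A q := by
  rw [trRpow_of_isHermitian hA.1]
  calc ∑ j, (inner ℂ (b j) (A.toEuclideanLin (b j))).re ^ q
      ≤ ∑ j, ∑ k, ‖inner ℂ (hA.1.eigenvectorBasis k) (b j)‖ ^ 2 * hA.1.eigenvalues k ^ q := by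
        refine Finset.sum_le_sum fun j _ => ?_
        rw [hA.1.re_inner_toEuclideanLin]
        refine Real.rpow_arith_mean_le_arith_mean_rpow _ _ _ (fun k _ => sq_nonneg _) ?_
          (fun k _ => hA.eigenvalues_nonneg k) hq
        rw [OrthonormalBasis.sum_sq_norm_inner_right, b.norm_eq_one, one_pow]
    _ = ∑ k, hA.1.eigenvalues k ^ q := by
        rw [Finset.sum_comm]
        refine Finset.sum_congr rfl fun k _ => ?_
        rw [← Finset.sum_mul, b.sum_sq_norm_inner_left, OrthonormalBasis.norm_eq_one, one_pow,
          one_mul]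

/-- Minkowski's inequality for a finite weighted sum of nonnegative vectors. -/
lemma Real.rpow_sum_rpow_sum_mul_le {ι κ : Type*} [Fintype ι] [Fintype κ] {q : ℝ} (hq : 1 ≤ q)
    {p : ι → ℝ} (hp : ∀ i, 0 ≤ p i) {a : ι → κ → ℝ} (ha : ∀ i j, 0 ≤ a i j) :
    (∑ j, (∑ i, p i * a i j) ^ q) ^ (1 / q) ≤ ∑ i, p i * (∑ j, a i j ^ q) ^ (1 / q) := by
  have hq0 : 0 < q := by linarith
  have : Fact (1 ≤ ENNReal.ofReal q) := ⟨by simpa using hq⟩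
  have htoReal : (ENNReal.ofReal q).toReal = q := ENNReal.toReal_ofReal hq0.le
  have hnorm (f : κ → ℝ) (hf : ∀ j, 0 ≤ f j) :
      ‖WithLp.toLp (ENNReal.ofReal q) f‖ = (∑ j, f j ^ q) ^ (1 / q) := by
    rw [PiLp.norm_eq_sum (by rwa [htoReal]), htoReal]
    simp only [Real.norm_of_nonneg (hf _)]
  have hle := norm_sum_le Finset.univ fun i => p i • WithLp.toLp (ENNReal.ofReal q) (a i)
  simp only [norm_smul, Real.norm_of_nonneg (hp _), hnorm _ (ha _)] at hle
  convert hle using 1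
  rw [← hnorm _ fun j => Finset.sum_nonneg fun i _ => mul_nonneg (hp i) (ha i j)]
  congr 1
  ext j
  simp

/-- Schatten norms satisfy the triangle inequality on positive semidefinite matrices. -/
lemma trRpow_sum_rpow_le {d : ℕ} {ι : Type*} [Fintype ι] {q : ℝ} (hq : 1 ≤ q)
    {ρ : ι → Matrix (Fin d) (Fin d) ℂ} (hρ : ∀ i, (ρ i).PosSemidef)
    {p : ι → ℝ} (hp : ∀ i, 0 ≤ p i) :
    trRpow (∑ i, (p i : ℂ) • ρ i) q ^ (1 / q) ≤ ∑ i, p i * trRpow (ρ i) q ^ (1 / q) := by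
  have hsum : (∑ i, (p i : ℂ) • ρ i).PosSemidef :=
    Matrix.posSemidef_sum _ fun i _ => (hρ i).smul (by exact_mod_cast hp i)
  set b := hsum.1.eigenvectorBasis with hb
  have heig (j : Fin d) : hsum.1.eigenvalues j =
      ∑ i, p i * (inner ℂ (b j) ((ρ i).toEuclideanLin (b j))).re := by
    rw [← hsum.1.re_inner_eigenvectorBasis, ← hb, map_sum, LinearMap.sum_apply, inner_sum,
      Complex.re_sum]
    refine Finset.sum_congr rfl fun i _ => ?_
    rw [map_smul, LinearMap.smul_apply, inner_smul_right, Complex.re_ofReal_mul]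
  rw [trRpow_of_isHermitian hsum.1]
  simp only [heig]
  refine (Real.rpow_sum_rpow_sum_mul_le hq hp fun i j =>
    (hρ i).re_inner_toEuclideanLin_nonneg (b j)).trans ?_
  gcongr with i
  · exact hp i
  · exact Finset.sum_nonneg fun j _ =>
      Real.rpow_nonneg ((hρ i).re_inner_toEuclideanLin_nonneg (b j)) q
  · exact sum_re_inner_rpow_le_trRpow (hρ i) b hq

/-- Concavity of `ρ ↦ 1 - (Tr ρ^q)^s` on density matrices, for `q ≥ 1`, `qs ≥ 1`. -/
theorem stmt2 (d n : ℕ) (q s : ℝ) (hq : 1 ≤ q) (hqs : 1 ≤ q * s)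
    (ρ : Fin n → Matrix (Fin d) (Fin d) ℂ)
    (hpsd : ∀ i, (ρ i).PosSemidef) (htr : ∀ i, (ρ i).trace = 1)
    (p : Fin n → ℝ) (hp : ∀ i, 0 ≤ p i) (hpsum : ∑ i, p i = 1) :
    ∑ i, p i * (1 - trRpow (ρ i) q ^ s) ≤
      1 - trRpow (∑ i, (p i : ℂ) • ρ i) q ^ s := by
  have hq0 : q ≠ 0 := by linarith
  have hsum : (∑ i, (p i : ℂ) • ρ i).PosSemidef :=
    Matrix.posSemidef_sum _ fun i _ => (hpsd i).smul (by exact_mod_cast hp i)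
  have hpow {x : ℝ} (hx : 0 ≤ x) : x ^ s = (x ^ (1 / q)) ^ (q * s) := by
    rw [← Real.rpow_mul hx, ← mul_assoc, one_div_mul_cancel hq0, one_mul]
  have hle : trRpow (∑ i, (p i : ℂ) • ρ i) q ^ s ≤ ∑ i, p i * trRpow (ρ i) q ^ s := by
    simp only [hpow (trRpow_nonneg hsum q), hpow (trRpow_nonneg (hpsd _) q)]
    refine (Real.rpow_le_rpow (Real.rpow_nonneg (trRpow_nonneg hsum q) _)
      (trRpow_sum_rpow_le hq hpsd hp) (by linarith)).trans ?_
    exact Real.rpow_arith_mean_le_arith_mean_rpow _ _ _ (fun i _ => hp i) hpsum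
      (fun i _ => Real.rpow_nonneg (trRpow_nonneg (hpsd i) q) _) hqs
  simp only [mul_sub, mul_one, Finset.sum_sub_distrib, hpsum]
  linarith
end

section
/- Let m ≥ 2 and let λ = (λ_1, …, λ_m) be a probability vector. Suppose 0 < q ≤ 1/2 and 0 < s < 0.9066. Then (Σ_{i=1}^m λ_i^q)^s − 1 ≥ [(m^{s(1−q)} − 1)/(m^s − 1)] · (((Σ_{i=1}^m √λ_i)^2)^s − 1). (For a bipartite pure state with Schmidt vector λ, (Σ_i √λ_i)^2 equals the trace norm of the partial transpose and of the realignment of its density matrix, so this is the pure-state case of the PPT/realignment lower bound on the unified (q,s)-concurrence in the regime 0 < q < 1.) -/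
/-- The chord of the concave function `t ↦ t ^ p` over `[1, b]` lies below its graph. -/
lemma rpow_chord_le {p b y : ℝ} (hp0 : 0 ≤ p) (hp1 : p ≤ 1) (hb : 1 < b) (hy1 : 1 ≤ y)
    (hyb : y ≤ b) : (b ^ p - 1) / (b - 1) * (y - 1) ≤ y ^ p - 1 := by
  have hpos : 0 < b - 1 := by linarith
  have h := (Real.concaveOn_rpow hp0 hp1).2 (Set.mem_Ici.2 zero_le_one)
    (Set.mem_Ici.2 (by linarith : 0 ≤ b))
    (div_nonneg (by linarith) hpos.le : 0 ≤ (b - y) / (b - 1))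
    (div_nonneg (by linarith) hpos.le : 0 ≤ (y - 1) / (b - 1))
    (by field_simp; ring)
  have hcomb : (b - y) / (b - 1) * 1 + (y - 1) / (b - 1) * b = y := by field_simp; ring
  simp only [smul_eq_mul, Real.one_rpow] at h
  rw [hcomb] at h
  have hval : (b - y) / (b - 1) * 1 + (y - 1) / (b - 1) * b ^ p
      = (b ^ p - 1) / (b - 1) * (y - 1) + 1 := by field_simp; ring
  linarith

/-- Hölder interpolation of the power sum of exponent `1 / 2` between those of exponents `q`
and `1`. -/
lemma sum_sqrt_rpow_le_sum_rpow {ι : Type*} [Fintype ι] {q : ℝ} (hq0 : 0 < q) (hq : q ≤ 1 / 2)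
    (v : ι → ℝ) (hv : ∀ i, 0 ≤ v i) (hsum : ∑ i, v i = 1) :
    (∑ i, √(v i)) ^ (2 * (1 - q)) ≤ ∑ i, v i ^ q := by
  have hp : 1 ≤ 2 * (1 - q) := by linarith
  have h := Real.inner_le_weight_mul_Lp_of_nonneg Finset.univ hp v
    (fun i ↦ v i ^ (-(1 / 2) : ℝ)) hv (fun i ↦ Real.rpow_nonneg (hv i) _)
  have hleft (i : ι) : v i * v i ^ (-(1 / 2) : ℝ) = √(v i) := by
    rcases (hv i).eq_or_lt with h0 | h0
    · simp [← h0]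
    · rw [Real.sqrt_eq_rpow, ← Real.rpow_one_add' h0.le (by norm_num)]
      norm_num
  have hright (i : ι) : v i * (v i ^ (-(1 / 2) : ℝ)) ^ (2 * (1 - q)) = v i ^ q := by
    rcases (hv i).eq_or_lt with h0 | h0
    · simp [← h0, Real.zero_rpow hq0.ne']
    · rw [← Real.rpow_mul h0.le, ← Real.rpow_one_add' h0.le (by linarith)]
      congr 1
      ring
  simp only [hleft, hright, hsum, Real.one_rpow, one_mul] at h
  have hS : 0 ≤ ∑ i, v i ^ q := Finset.sum_nonneg fun i _ ↦ Real.rpow_nonneg (hv i) _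
  calc (∑ i, √(v i)) ^ (2 * (1 - q))
      ≤ ((∑ i, v i ^ q) ^ (2 * (1 - q))⁻¹) ^ (2 * (1 - q)) :=
        Real.rpow_le_rpow (Finset.sum_nonneg fun i _ ↦ Real.sqrt_nonneg _) h (by linarith)
    _ = ∑ i, v i ^ q := Real.rpow_inv_rpow hS (by linarith)

lemma one_le_sum_sqrt {ι : Type*} [Fintype ι] (v : ι → ℝ) (hv : ∀ i, 0 ≤ v i)
    (hsum : ∑ i, v i = 1) : 1 ≤ ∑ i, √(v i) := by
  rw [← hsum]
  refine Finset.sum_le_sum fun i _ ↦ Real.le_sqrt_of_sq_le ?_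
  have : v i ≤ 1 := hsum ▸ Finset.single_le_sum (fun j _ ↦ hv j) (Finset.mem_univ i)
  nlinarith [hv i]

lemma sq_sum_sqrt_le_card {ι : Type*} [Fintype ι] (v : ι → ℝ) (hv : ∀ i, 0 ≤ v i)
    (hsum : ∑ i, v i = 1) : (∑ i, √(v i)) ^ 2 ≤ Fintype.card ι := by
  have h := sq_sum_le_card_mul_sum_sq (s := Finset.univ) (f := fun i ↦ √(v i))
  simpa [Real.sq_sqrt (hv _), hsum] using h

/-- Pure-state case of the PPT/realignment lower bound on the unified
(q,s)-concurrence in the regime `0 < q ≤ 1/2`, `0 < s < 0.9066`. -/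
theorem stmt8 (m : ℕ) (hm : 2 ≤ m) (q s : ℝ) (hq0 : 0 < q) (hq : q ≤ 1 / 2)
    (hs0 : 0 < s) (hs : s < 0.9066)
    (lam : Fin m → ℝ) (hnonneg : ∀ i, 0 ≤ lam i) (hsum : ∑ i, lam i = 1) :
    ((m : ℝ) ^ (s * (1 - q)) - 1) / ((m : ℝ) ^ s - 1) *
        ((((∑ i, Real.sqrt (lam i)) ^ 2) ^ s) - 1)
      ≤ (∑ i, lam i ^ q) ^ s - 1 := by
  have hm1 : (1 : ℝ) < m := by exact_mod_cast hm
  have hT := one_le_sum_sqrt lam hnonneg hsum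
  have hTm : (∑ i, √(lam i)) ^ 2 ≤ m := by simpa using sq_sum_sqrt_le_card lam hnonneg hsum
  have hHolder := sum_sqrt_rpow_le_sum_rpow hq0 hq lam hnonneg hsum
  set T := ∑ i, √(lam i)
  have hT0 : 0 ≤ T := by linarith
  have hx : 1 ≤ T ^ 2 := one_le_pow₀ hT
  rw [Real.rpow_mul (by linarith)]
  refine (rpow_chord_le (by linarith) (by linarith) (Real.one_lt_rpow hm1 hs0)
    (Real.one_le_rpow hx hs0.le) (Real.rpow_le_rpow (by linarith) hTm hs0.le)).trans ?_
  have hpow : ((T ^ 2) ^ s) ^ (1 - q) = (T ^ (2 * (1 - q))) ^ s := by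
    rw [← Real.rpow_natCast, ← Real.rpow_mul hT0, ← Real.rpow_mul hT0, ← Real.rpow_mul hT0]
    congr 1
    push_cast
    ring
  rw [hpow]
  gcongr
end

section
/- Let d ≥ 2, let 1/d < F ≤ 1, and let q ≥ 1 with qs ≥ 1. Set γ = (√F + √((d−1)(1−F)))/√d and δ = (√F − √((1−F)/(d−1)))/√d. Then for every probability vector λ = (λ_1, …, λ_d) satisfying Σ_{i=1}^d √λ_i = √(Fd), one has 1 − (Σ_{i=1}^d λ_i^q)^s ≥ 1 − (γ^{2q} + (d−1)δ^{2q})^s, and this bound is attained by the probability vector (γ^2, δ^2, …, δ^2). (This identifies the minimum of the unified (q,s)-concurrence over pure states of fixed fidelity F with the maximally entangled state, which yields the formula for isotropic states.) -/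
/-- A function with convex derivative that vanishes doubly at `a` and vanishes at `b > a` is
nonpositive to the left of `b`. -/
theorem nonpos_of_convexOn_deriv {h h' : ℝ → ℝ} {s : Set ℝ} {a b x : ℝ}
    (hd : ∀ y ∈ s, HasDerivAt h (h' y) y) (hc : ConvexOn ℝ s h')
    (ha : a ∈ s) (hb : b ∈ s) (hx : x ∈ s) (hab : a < b) (hxb : x ≤ b)
    (ha0 : h a = 0) (ha1 : h' a = 0) (hb0 : h b = 0) : h x ≤ 0 := by
  have mvt : ∀ u ∈ s, ∀ v ∈ s, u < v →
      ∃ c ∈ Set.Ioo u v, c ∈ s ∧ h v - h u = h' c * (v - u) := by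
    intro u hu v hv huv
    have hsub : Set.Icc u v ⊆ s := hc.1.ordConnected.out hu hv
    obtain ⟨c, hcm, hceq⟩ := exists_hasDerivAt_eq_slope h h' huv
      (fun y hy => (hd y (hsub hy)).continuousAt.continuousWithinAt)
      (fun y hy => hd y (hsub (Set.Ioo_subset_Icc_self hy)))
    refine ⟨c, hcm, hsub (Set.Ioo_subset_Icc_self hcm), ?_⟩
    rw [hceq, div_mul_cancel₀ _ (sub_pos.2 huv).ne']
  by_contra! hpos
  rcases lt_trichotomy x a with hxa | rfl | hax
  · obtain ⟨c, hc1, hcs, hce⟩ := mvt x hx a ha hxa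
    obtain ⟨e, he1, hes, hee⟩ := mvt a ha b hb hab
    have he0 : h' e = 0 := by
      rw [ha0, hb0, sub_self] at hee
      exact (mul_eq_zero.1 hee.symm).resolve_right (sub_pos.2 hab).ne'
    have hcneg : h' c < 0 := by
      by_contra! hn
      have := mul_nonneg hn (sub_pos.2 hxa).le
      linarith
    have := hc.secant_mono_aux1 hcs hes hc1.2 he1.1
    rw [ha1, he0] at this
    have := mul_neg_of_pos_of_neg (sub_pos.2 he1.1) hcneg
    linarith
  · linarith
  · rcases hxb.eq_or_lt with rfl | hxb
    · linarith
    obtain ⟨c, hc1, hcs, hce⟩ := mvt a ha x hx hax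
    obtain ⟨e, he1, hes, hee⟩ := mvt x hx b hb hxb
    have hcpos : 0 < h' c := by
      by_contra! hn
      have := mul_nonpos_of_nonpos_of_nonneg hn (sub_pos.2 hax).le
      linarith
    have heneg : h' e < 0 := by
      by_contra! hn
      have := mul_nonneg hn (sub_pos.2 hxb).le
      linarith
    have hce' : c < e := hc1.2.trans he1.1
    have := hc.secant_mono_aux1 ha hes hc1.1 hce'
    rw [ha1] at this
    have := mul_neg_of_pos_of_neg (sub_pos.2 hc1.1) heneg
    have := mul_pos (sub_pos.2 (hc1.1.trans hce')) hcpos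
    linarith

/-- The quadratic interpolating `x ^ p` doubly at `a` and simply at `b > a` dominates `x ^ p`
on `[0, b]` when `2 ≤ p`. -/
theorem exists_quadratic_ge_rpow {p a b : ℝ} (hp : 2 ≤ p) (ha : 0 ≤ a) (hab : a < b) :
    ∃ A B C : ℝ, a ^ p = A * a ^ 2 + B * a + C ∧ b ^ p = A * b ^ 2 + B * b + C ∧
      ∀ x, 0 ≤ x → x ≤ b → x ^ p ≤ A * x ^ 2 + B * x + C := by
  set k : ℝ := p * a ^ (p - 1) with hk
  set A : ℝ := (b ^ p - a ^ p - k * (b - a)) / (b - a) ^ 2 with hA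
  have hA' : A * (b - a) ^ 2 = b ^ p - a ^ p - k * (b - a) :=
    div_mul_cancel₀ _ (pow_ne_zero 2 (sub_pos.2 hab).ne')
  refine ⟨A, k - 2 * A * a, a ^ p - k * a + A * a ^ 2, by ring, by linarith, ?_⟩
  intro x hx hxb
  have hderiv : ∀ y ∈ Set.Ici (0 : ℝ), HasDerivAt
      (fun y => y ^ p - (A * y ^ 2 + (k - 2 * A * a) * y + (a ^ p - k * a + A * a ^ 2)))
      (p * y ^ (p - 1) + (-(2 * A) * y + -(k - 2 * A * a))) y := by
    intro y _
    have h1 := Real.hasDerivAt_rpow_const (x := y) (p := p) (Or.inr (by linarith))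
    have h2 := ((((hasDerivAt_id y).pow 2).const_mul A).add
      ((hasDerivAt_id y).const_mul (k - 2 * A * a))).add_const (a ^ p - k * a + A * a ^ 2)
    refine (h1.sub h2).congr_deriv ?_
    simp only [id, Nat.cast_ofNat, Nat.add_one_sub_one, pow_one]
    ring
  have hconv : ConvexOn ℝ (Set.Ici (0 : ℝ))
      (fun y => p * y ^ (p - 1) + (-(2 * A) * y + -(k - 2 * A * a))) := by
    refine ((convexOn_rpow (p := p - 1) (by linarith)).smul (by linarith : 0 ≤ p)).add ?_
    refine ⟨convex_Ici 0, fun u _ v _ α β _ _ hαβ => le_of_eq ?_⟩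
    simp only [smul_eq_mul]
    linear_combination (k - 2 * A * a) * hαβ
  have := nonpos_of_convexOn_deriv hderiv hconv (a := a) (b := b) (x := x) ha
    (ha.trans hab.le) hx hab hxb (by ring) (by rw [hk]; ring) (by linarith)
  linarith

/-- A member of a finite family of reals with sum `S` and sum of squares `T` satisfies the
Cauchy-Schwarz bound coming from the remaining members. -/
theorem sq_sub_le_of_sum_eq {ι : Type*} [Fintype ι] {x : ι → ℝ} {S T : ℝ}
    (h1 : ∑ i, x i = S) (h2 : ∑ i, x i ^ 2 = T) (i : ι) :
    (S - x i) ^ 2 ≤ ((Fintype.card ι : ℝ) - 1) * (T - x i ^ 2) := by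
  classical
  have e1 := Finset.add_sum_erase Finset.univ x (Finset.mem_univ i)
  have e2 := Finset.add_sum_erase Finset.univ (fun j => x j ^ 2) (Finset.mem_univ i)
  have := sq_sum_le_card_mul_sum_sq (s := Finset.univ.erase i) (f := x)
  rw [Finset.card_erase_of_mem (Finset.mem_univ i), Finset.card_univ,
    Nat.cast_sub (Fintype.card_pos_iff.2 ⟨i⟩), Nat.cast_one] at this
  rw [← h1, ← h2, ← e1, ← e2]
  simpa using this

/-- Among nonnegative vectors with the same sum and sum of squares as `(b, a, …, a)`, `a ≤ b`,
the power sum of exponent `p ≥ 2` is largest at `(b, a, …, a)`. -/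
theorem sum_rpow_le_of_sum_eq {ι : Type*} [Fintype ι] {x : ι → ℝ} {p a b : ℝ} (hp : 2 ≤ p)
    (ha : 0 ≤ a) (hab : a ≤ b) (hx : ∀ i, 0 ≤ x i) (hxb : ∀ i, x i ≤ b)
    (h1 : ∑ i, x i = b + ((Fintype.card ι : ℝ) - 1) * a)
    (h2 : ∑ i, x i ^ 2 = b ^ 2 + ((Fintype.card ι : ℝ) - 1) * a ^ 2) :
    ∑ i, x i ^ p ≤ b ^ p + ((Fintype.card ι : ℝ) - 1) * a ^ p := by
  rcases hab.eq_or_lt with rfl | hab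
  · calc ∑ i, x i ^ p ≤ ∑ _i : ι, a ^ p := Finset.sum_le_sum fun i _ =>
          Real.rpow_le_rpow (hx i) (hxb i) (by linarith)
      _ = _ := by simp; ring
  · obtain ⟨A, B, C, hA, hB, hle⟩ := exists_quadratic_ge_rpow hp ha hab
    calc ∑ i, x i ^ p ≤ ∑ i, (A * x i ^ 2 + B * x i + C) :=
          Finset.sum_le_sum fun i _ => hle _ (hx i) (hxb i)
      _ = A * ∑ i, x i ^ 2 + B * ∑ i, x i + Fintype.card ι * C := by
          simp [Finset.sum_add_distrib, Finset.mul_sum]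
      _ = _ := by rw [h1, h2, hA, hB]; ring

theorem Fin.sum_ite_val_eq_zero {d : ℕ} (hd : 0 < d) (A B : ℝ) :
    ∑ i : Fin d, (if (i : ℕ) = 0 then A else B) = A + ((d : ℝ) - 1) * B := by
  obtain ⟨n, rfl⟩ := Nat.exists_eq_succ_of_ne_zero hd.ne'
  simp [Fin.sum_univ_succ]


/-- Minimization of the unified (q,s)-concurrence over pure states of fixed
fidelity `F` with the maximally entangled state (isotropic-state formula):
the minimum is attained at the Schmidt vector `(γ², δ², …, δ²)`. -/
theorem stmt9 (d : ℕ) (hd : 2 ≤ d) (F q s : ℝ)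
    (hF1 : 1 / (d : ℝ) < F) (hF2 : F ≤ 1) (hq : 1 ≤ q) (hqs : 1 ≤ q * s) :
    let γ : ℝ := (Real.sqrt F + Real.sqrt (((d : ℝ) - 1) * (1 - F))) / Real.sqrt d
    let δ : ℝ := (Real.sqrt F - Real.sqrt ((1 - F) / ((d : ℝ) - 1))) / Real.sqrt d
    (∀ lam : Fin d → ℝ, (∀ i, 0 ≤ lam i) → ∑ i, lam i = 1 →
        ∑ i, Real.sqrt (lam i) = Real.sqrt (F * d) →
        1 - (γ ^ (2 * q) + ((d : ℝ) - 1) * δ ^ (2 * q)) ^ s ≤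
          1 - (∑ i, lam i ^ q) ^ s) ∧
    (let μ : Fin d → ℝ := fun i => if (i : ℕ) = 0 then γ ^ 2 else δ ^ 2;
      (∀ i, 0 ≤ μ i) ∧ ∑ i, μ i = 1 ∧
        ∑ i, Real.sqrt (μ i) = Real.sqrt (F * d) ∧
        1 - (∑ i, μ i ^ q) ^ s =
          1 - (γ ^ (2 * q) + ((d : ℝ) - 1) * δ ^ (2 * q)) ^ s) := by
  intro γ δ
  have hd' : (2 : ℝ) ≤ d := by exact_mod_cast hd
  have hm : (0 : ℝ) < d - 1 := by linarith
  have hd0 : (0 : ℝ) < d := by linarith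
  have hF0 : 0 < F := lt_trans (by positivity) hF1
  have hFd : 1 < F * d := (div_lt_iff₀ hd0).1 hF1
  obtain ⟨a, ha⟩ : ∃ a, a = √F := ⟨_, rfl⟩
  obtain ⟨b, hb⟩ : ∃ b, b = √(1 - F) := ⟨_, rfl⟩
  obtain ⟨r, hr⟩ : ∃ r, r = √((d : ℝ) - 1) := ⟨_, rfl⟩
  obtain ⟨D, hD⟩ : ∃ D, D = √(d : ℝ) := ⟨_, rfl⟩
  have ha0 : 0 ≤ a := ha ▸ Real.sqrt_nonneg _
  have hb0 : 0 ≤ b := hb ▸ Real.sqrt_nonneg _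
  have hr0 : 0 < r := hr ▸ Real.sqrt_pos.2 hm
  have hD0 : 0 < D := hD ▸ Real.sqrt_pos.2 hd0
  have ha2 : a ^ 2 = F := by rw [ha, Real.sq_sqrt hF0.le]
  have hb2 : b ^ 2 = 1 - F := by rw [hb, Real.sq_sqrt (by linarith)]
  have hr2 : r ^ 2 = d - 1 := by rw [hr, Real.sq_sqrt hm.le]
  have hD2 : D ^ 2 = d := by rw [hD, Real.sq_sqrt hd0.le]
  have hγ : γ = (a + r * b) / D := by
    simp only [γ]; rw [Real.sqrt_mul hm.le, ← ha, ← hb, ← hr, ← hD]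
  have hδ : δ = (a - b / r) / D := by
    simp only [δ]; rw [Real.sqrt_div' _ hm.le, ← ha, ← hb, ← hr, ← hD]
  have hS : √(F * d) = a * D := by rw [Real.sqrt_mul hF0.le, ← ha, ← hD]
  clear_value γ δ
  have hδ0 : 0 ≤ δ := by
    rw [hδ]
    refine div_nonneg (sub_nonneg.2 ((div_le_iff₀ hr0).2 ?_)) hD0.le
    refine abs_le_of_sq_le_sq' ?_ (by positivity) |>.2
    rw [mul_pow, ha2, hb2, hr2]
    linarith
  have hδγ : δ ≤ γ := by
    rw [hγ, hδ]
    gcongr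
    have : 0 ≤ b / r := by positivity
    have : 0 ≤ r * b := by positivity
    linarith
  have hsum1 : γ + ((d : ℝ) - 1) * δ = a * D := by
    rw [hγ, hδ, ← hr2]
    field_simp
    linear_combination a * hr2 - a * hD2
  have hsum2 : γ ^ 2 + ((d : ℝ) - 1) * δ ^ 2 = 1 := by
    rw [hγ, hδ, ← hr2]
    field_simp
    have hDr : D ^ 2 = r ^ 2 + 1 := by linarith
    have hab : a ^ 2 + b ^ 2 = 1 := by linarith
    rw [hDr]
    linear_combination (r ^ 2 + 1) * hab
  have hs : 0 ≤ s := by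
    by_contra! hs
    nlinarith
  have hpow : ∀ x : ℝ, 0 ≤ x → x ^ (2 * q) = (x ^ 2) ^ q := fun x hx => by
    rw [Real.rpow_mul hx, Real.rpow_two]
  refine ⟨fun lam h0 h1 h2 => ?_, ?_, ?_, ?_, ?_⟩
  · have hsq : ∀ i, √(lam i) ^ 2 = lam i := fun i => Real.sq_sqrt (h0 i)
    have hsqsum : ∑ i, √(lam i) ^ 2 = 1 := by simp only [hsq, h1]
    rw [hS] at h2
    have hle : ∀ i, √(lam i) ≤ γ := by
      intro i
      have hi := sq_sub_le_of_sum_eq h2 hsqsum i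
      rw [Fintype.card_fin] at hi
      rw [hγ, le_div_iff₀ hD0]
      have : (√(lam i) * D - a) ^ 2 ≤ (r * b) ^ 2 := by
        rw [mul_pow, hr2, hb2]
        nlinarith
      have := (abs_le_of_sq_le_sq' this (by positivity)).2
      linarith
    have hmain := sum_rpow_le_of_sum_eq (p := 2 * q) (by linarith) hδ0 hδγ
      (fun i => Real.sqrt_nonneg (lam i)) hle
      (by rw [h2, Fintype.card_fin, hsum1]) (by rw [hsqsum, Fintype.card_fin, hsum2])
    simp only [hpow _ (Real.sqrt_nonneg _), hsq, Fintype.card_fin] at hmain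
    have := Real.rpow_le_rpow
      (Finset.sum_nonneg fun i _ => Real.rpow_nonneg (h0 i) q) hmain hs
    linarith
  · intro i
    dsimp only
    split_ifs <;> positivity
  · rw [Fin.sum_ite_val_eq_zero (by omega), hsum2]
  · simp only [apply_ite Real.sqrt, Real.sqrt_sq hδ0, Real.sqrt_sq (hδ0.trans hδγ)]
    rw [Fin.sum_ite_val_eq_zero (by omega), hsum1, hS]
  · simp only [apply_ite (fun t : ℝ => t ^ q)]
    rw [Fin.sum_ite_val_eq_zero (by omega), hpow _ hδ0, hpow _ (hδ0.trans hδγ)]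
end

section
/- Let q > 1, 0 < s ≤ 1 and 1 ≤ qs ≤ 3. Then the function h_{q,s}(x) = [1 − (((1+√(1−x²))/2)^q + ((1−√(1−x²))/2)^q)^s]/(1 − 2^{s(1−q)}) is monotonically nondecreasing and convex on the interval [0, 1]. -/
/-- The function `h_{q,s}` relating concurrence to the normalized
unified (q,s)-concurrence. -/
noncomputable def hqs (q s x : ℝ) : ℝ :=
  (1 - (((1 + Real.sqrt (1 - x ^ 2)) / 2) ^ q +
      ((1 - Real.sqrt (1 - x ^ 2)) / 2) ^ q) ^ s) /
    (1 - (2 : ℝ) ^ (s * (1 - q)))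

open Real

/-- The logarithm, up to an additive constant, of minus the derivative of the `s`-th power of
`((1 + √(1 - x ^ 2)) / 2) ^ q + ((1 - √(1 - x ^ 2)) / 2) ^ q` at `x = 1 / cosh y`. -/
noncomputable def logSlope (q s y : ℝ) : ℝ :=
  (s - 1) * log (2 * cosh (q * y)) + log (2 * sinh ((q - 1) * y))
    - (q * s - 1) * log (2 * cosh y) - log (sinh y)

/-- The base of the `s`-th power in `hqs q s`. -/
noncomputable def powSum (q x : ℝ) : ℝ :=
  ((1 + √(1 - x ^ 2)) / 2) ^ q + ((1 - √(1 - x ^ 2)) / 2) ^ q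

theorem sinh_le_mul_cosh {y : ℝ} (hy : 0 ≤ y) : sinh y ≤ y * cosh y := by
  have hd (x : ℝ) : HasDerivAt (fun x => x * cosh x - sinh x) (x * sinh x) x := by
    refine (((hasDerivAt_id' x).fun_mul (hasDerivAt_cosh x)).fun_sub
      (hasDerivAt_sinh x)).congr_deriv ?_
    ring
  have hm : MonotoneOn (fun x => x * cosh x - sinh x) (Set.Ici 0) := by
    refine monotoneOn_of_deriv_nonneg (convex_Ici 0) (by fun_prop) (by fun_prop) fun x hx => ?_
    rw [interior_Ici, Set.mem_Ioi] at hx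
    rw [(hd x).deriv]
    exact mul_nonneg hx.le (sinh_nonneg_iff.2 hx.le)
  have := hm (Set.mem_Ici.2 le_rfl) hy hy
  simp at this
  linarith

theorem mul_sinh_le_sinh_mul {p y : ℝ} (hp : 1 ≤ p) (hy : 0 ≤ y) :
    p * sinh y ≤ sinh (p * y) := by
  have hd (x : ℝ) : HasDerivAt (fun x => sinh (p * x) - p * sinh x)
      (cosh (p * x) * p - p * cosh x) x := by
    refine (((hasDerivAt_id' x).const_mul p).sinh.fun_sub
      ((hasDerivAt_sinh x).const_mul p)).congr_deriv ?_
    ring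
  have hm : MonotoneOn (fun x => sinh (p * x) - p * sinh x) (Set.Ici 0) := by
    refine monotoneOn_of_deriv_nonneg (convex_Ici 0) (by fun_prop) (by fun_prop) fun x hx => ?_
    rw [interior_Ici, Set.mem_Ioi] at hx
    rw [(hd x).deriv]
    have : cosh x ≤ cosh (p * x) := by
      rw [cosh_le_cosh, abs_of_pos hx, abs_of_pos (by positivity)]
      nlinarith
    nlinarith
  have := hm (Set.mem_Ici.2 le_rfl) hy hy
  simp at this
  linarith

theorem mul_sinh_le_cosh_mul_sinh_mul {p y : ℝ} (hp : 0 ≤ p) (hy : 0 ≤ y) :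
    p * sinh y ≤ cosh y * sinh (p * y) := by
  have h1 := mul_le_mul_of_nonneg_left (sinh_le_mul_cosh hy) hp
  have h2 : p * y ≤ sinh (p * y) := self_le_sinh_iff.2 (by positivity)
  nlinarith [cosh_pos y]

theorem hyperbolic_slope_inequality {p c y : ℝ} (hp : 0 < p) (hc2 : c ≤ 2) (hcp : c ≤ p)
    (hy : 0 < y) :
    p * sinh y * cosh y ^ 2 + c * sinh (p * y) ^ 2 * sinh y ≤
      sinh (p * y) * cosh (p * y + y) * cosh y ^ 2 := by
  have hS : 0 < sinh (p * y) := sinh_pos_iff.2 (by positivity)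
  have hs : 0 < sinh y := sinh_pos_iff.2 hy
  have hC := cosh_pos y
  have hC1 := one_le_cosh y
  have hadd := cosh_add (p * y) y
  have hsub := cosh_sub (p * y) y
  have hsq := cosh_sq (p * y)
  have hsq' := cosh_sq y
  rcases le_total 1 p with h | h
  · have h1 := mul_sinh_le_sinh_mul h hy.le
    have h2 : 1 ≤ cosh (p * y - y) := one_le_cosh _
    have h3 : 2 * sinh y * sinh (p * y) ≤ cosh (p * y + y) - 1 := by linarith
    have h4 : c * sinh y * sinh (p * y) ≤ cosh y ^ 2 * (cosh (p * y + y) - 1) := by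
      have h5 : 0 < sinh y * sinh (p * y) := mul_pos hs hS
      have h6 : 1 ≤ cosh y ^ 2 := by nlinarith
      nlinarith
    nlinarith [mul_le_mul_of_nonneg_left h4 hS.le,
      mul_le_mul_of_nonneg_left h1 (sq_nonneg (cosh y))]
  · have h1 := mul_sinh_le_cosh_mul_sinh_mul hp.le hy.le
    have h2 : cosh (p * y - y) ≤ cosh y := by
      rw [cosh_le_cosh, abs_of_pos hy, abs_le]
      constructor <;> nlinarith
    have h3 : sinh (p * y) ^ 2 + cosh y ^ 2 = cosh (p * y + y) * cosh (p * y - y) := by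
      rw [hadd, hsub]
      linear_combination -cosh y ^ 2 * hsq - sinh (p * y) ^ 2 * hsq'
    have hQ := cosh_pos (p * y + y)
    have hcs : c * (sinh (p * y) ^ 2 * sinh y) ≤ p * (sinh (p * y) ^ 2 * sinh y) :=
      mul_le_mul_of_nonneg_right hcp (by positivity)
    have h4 : p * sinh y * (cosh (p * y + y) * cosh (p * y - y)) ≤
        p * sinh y * (cosh (p * y + y) * cosh y) := by gcongr
    have h5 := mul_le_mul_of_nonneg_right h1 (mul_pos hQ hC).le
    rw [← h3] at h4
    nlinarith

theorem antitoneOn_logSlope {q s : ℝ} (hq : 1 < q) (hs1 : s ≤ 1) (hqs3 : q * s ≤ 3) :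
    AntitoneOn (logSlope q s) (Set.Ioi 0) := by
  have hd (y : ℝ) (hy : 0 < y) : HasDerivAt (logSlope q s)
      ((s - 1) * (2 * (sinh (q * y) * q) / (2 * cosh (q * y)))
        + 2 * (cosh ((q - 1) * y) * (q - 1)) / (2 * sinh ((q - 1) * y))
        - (q * s - 1) * (2 * sinh y / (2 * cosh y)) - cosh y / sinh y) y := by
    have hS : 0 < sinh ((q - 1) * y) := sinh_pos_iff.2 (mul_pos (by linarith) hy)
    have hs : 0 < sinh y := sinh_pos_iff.2 hy
    have hm (r : ℝ) : HasDerivAt (fun y => r * y) r y := by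
      simpa using (hasDerivAt_id y).const_mul r
    exact (((((hm q).cosh.const_mul 2).log (by positivity)).const_mul (s - 1)).add
      (((hm (q - 1)).sinh.const_mul 2).log (by positivity))).sub
      ((((hasDerivAt_cosh y).const_mul 2).log (by positivity)).const_mul (q * s - 1)) |>.sub
      ((hasDerivAt_sinh y).log hs.ne')
  refine antitoneOn_of_deriv_nonpos (convex_Ioi 0)
    (fun y hy => (hd y hy).continuousAt.continuousWithinAt)
    (fun y hy => (hd y (interior_subset hy)).differentiableAt.differentiableWithinAt)
    fun y hy => ?_
  rw [interior_Ioi, Set.mem_Ioi] at hy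
  rw [(hd y hy).deriv]
  have hS : 0 < sinh ((q - 1) * y) := sinh_pos_iff.2 (mul_pos (by linarith) hy)
  have hs : 0 < sinh y := sinh_pos_iff.2 hy
  have hC := cosh_pos y
  have hQ := cosh_pos (q * y)
  have key := hyperbolic_slope_inequality (p := q - 1) (c := q * s - 1) (by linarith)
    (by linarith) (by nlinarith) hy
  have hqy : q * y = (q - 1) * y + y := by ring
  have hsinh : sinh (q * y) = _ := (congrArg sinh hqy).trans (sinh_add _ _)
  have hcosh : cosh (q * y) = _ := (congrArg cosh hqy).trans (cosh_add _ _)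
  rw [← hqy] at key
  have hsq := cosh_sq ((q - 1) * y)
  have hsq' := cosh_sq y
  have heq : (s - 1) * (2 * (sinh (q * y) * q) / (2 * cosh (q * y)))
        + 2 * (cosh ((q - 1) * y) * (q - 1)) / (2 * sinh ((q - 1) * y))
        - (q * s - 1) * (2 * sinh y / (2 * cosh y)) - cosh y / sinh y =
      ((q - 1) * sinh y * cosh y ^ 2 + (q * s - 1) * sinh ((q - 1) * y) ^ 2 * sinh y -
      sinh ((q - 1) * y) * cosh (q * y) * cosh y ^ 2) /
        (sinh ((q - 1) * y) * cosh (q * y) * cosh y * sinh y) := by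
    clear hd key hqy
    generalize sinh (q * y) = R at *
    generalize cosh (q * y) = Q at *
    generalize sinh ((q - 1) * y) = S at *
    generalize cosh ((q - 1) * y) = D at *
    generalize sinh y = a at *
    generalize cosh y = b at *
    field_simp
    rw [hsinh, hcosh]
    linear_combination a * (q * s - 1) * S ^ 2 * hsq' + a * (q - 1) * b ^ 2 * hsq
  rw [heq]
  exact div_nonpos_of_nonpos_of_nonneg (by linarith) (by positivity)

theorem hasDerivAt_powSum_rpow {q s y : ℝ} (hq : 1 < q) (hy : 0 < y) :
    HasDerivAt (fun x => powSum q x ^ s) (-(q * s / 2 * exp (logSlope q s y))) (cosh y)⁻¹ := by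
  have hs : 0 < sinh y := sinh_pos_iff.2 hy
  have hC := cosh_pos y
  have hS : 0 < sinh ((q - 1) * y) := sinh_pos_iff.2 (mul_pos (by linarith) hy)
  have hQ := cosh_pos (q * y)
  have harg : 1 - (cosh y)⁻¹ ^ 2 = (sinh y / cosh y) ^ 2 := by
    have := cosh_sq y
    field_simp
    linarith
  have hsqrt : √(1 - (cosh y)⁻¹ ^ 2) = sinh y / cosh y := by
    rw [harg, sqrt_sq (by positivity)]
  have hexpL : exp (log (2 * cosh y)) = 2 * cosh y := exp_log (by positivity)
  have ha : (1 + sinh y / cosh y) / 2 = exp (y - log (2 * cosh y)) := by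
    rw [exp_sub, hexpL, ← cosh_add_sinh]
    field_simp
  have hb : (1 - sinh y / cosh y) / 2 = exp (-y - log (2 * cosh y)) := by
    rw [exp_sub, hexpL, ← cosh_sub_sinh]
    field_simp
  have hF : exp (y - log (2 * cosh y)) ^ q + exp (-y - log (2 * cosh y)) ^ q =
      exp (log (2 * cosh (q * y)) - q * log (2 * cosh y)) := by
    rw [← exp_mul, ← exp_mul, exp_sub (log _), exp_log (by positivity), cosh_eq (q * y),
      div_eq_mul_inv, ← exp_neg, mul_div_cancel₀ _ two_ne_zero, add_mul, ← exp_add, ← exp_add]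
    ring_nf
  have hD : exp (y - log (2 * cosh y)) ^ (q - 1) - exp (-y - log (2 * cosh y)) ^ (q - 1) =
      exp (log (2 * sinh ((q - 1) * y)) - (q - 1) * log (2 * cosh y)) := by
    rw [← exp_mul, ← exp_mul, exp_sub (log _), exp_log (by positivity), sinh_eq ((q - 1) * y),
      div_eq_mul_inv, ← exp_neg, mul_div_cancel₀ _ two_ne_zero, sub_mul (exp _), ← exp_add,
      ← exp_add]
    ring_nf
  have hroot : HasDerivAt (fun x => √(1 - x ^ 2)) (-(sinh y)⁻¹) (cosh y)⁻¹ := by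
    have h := (((hasDerivAt_id' (cosh y)⁻¹).fun_pow 2).const_sub 1).sqrt
      (by rw [harg]; positivity)
    convert h using 1
    rw [hsqrt, pow_one]
    field_simp
    norm_num
  have hpos : HasDerivAt (powSum q) _ (cosh y)⁻¹ :=
    (((hroot.const_add 1).div_const 2).rpow_const (p := q)
      (Or.inl (by rw [hsqrt, ha]; positivity))).add
    (((hroot.const_sub 1).div_const 2).rpow_const (p := q)
      (Or.inl (by rw [hsqrt, hb]; positivity)))
  have hval : powSum q (cosh y)⁻¹ = exp (log (2 * cosh (q * y)) - q * log (2 * cosh y)) := by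
    rw [powSum, hsqrt, ha, hb, hF]
  convert hpos.rpow_const (p := s) (Or.inl (by rw [hval]; positivity)) using 1
  rw [hval, hsqrt, ha, hb]
  have hslope : exp (logSlope q s y) =
      exp (log (2 * cosh (q * y)) - q * log (2 * cosh y)) ^ (s - 1) *
        exp (log (2 * sinh ((q - 1) * y)) - (q - 1) * log (2 * cosh y)) * (sinh y)⁻¹ := by
    rw [logSlope, ← exp_mul, ← exp_add, ← exp_log (inv_pos.2 hs), ← exp_add, log_inv]
    ring_nf
  rw [hslope, ← hD]
  ring

theorem continuous_powSum_rpow {q s : ℝ} (hq : 0 ≤ q) (hs : 0 ≤ s) :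
    Continuous fun x => powSum q x ^ s := by
  unfold powSum
  refine Continuous.rpow_const (.add ?_ ?_) fun _ => Or.inr hs <;>
    exact Continuous.rpow_const (by fun_prop) fun _ => Or.inr hq

theorem exists_cosh_inv_eq {x : ℝ} (hx : x ∈ Set.Ioo (0 : ℝ) 1) :
    ∃ y, 0 < y ∧ (cosh y)⁻¹ = x :=
  have h := (one_lt_inv₀ hx.1).2 hx.2
  ⟨arcosh x⁻¹, arcosh_pos h, by rw [cosh_arcosh h.le, inv_inv]⟩

theorem antitoneOn_powSum_rpow {q s : ℝ} (hq : 1 < q) (hs : 0 ≤ s) :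
    AntitoneOn (fun x => powSum q x ^ s) (Set.Icc 0 1) := by
  refine antitoneOn_of_deriv_nonpos (convex_Icc 0 1)
    (continuous_powSum_rpow (by linarith) hs).continuousOn (fun x hx => ?_) fun x hx => ?_ <;>
  rw [interior_Icc] at hx <;>
  obtain ⟨y, hy, rfl⟩ := exists_cosh_inv_eq hx
  · exact (hasDerivAt_powSum_rpow hq hy).differentiableAt.differentiableWithinAt
  · rw [(hasDerivAt_powSum_rpow hq hy).deriv, neg_nonpos]
    have : 0 ≤ q := by linarith
    positivity

theorem concaveOn_powSum_rpow {q s : ℝ} (hq : 1 < q) (hs0 : 0 ≤ s) (hs1 : s ≤ 1)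
    (hqs3 : q * s ≤ 3) : ConcaveOn ℝ (Set.Icc 0 1) fun x => powSum q x ^ s := by
  refine AntitoneOn.concaveOn_of_deriv (convex_Icc 0 1)
    (continuous_powSum_rpow (by linarith) hs0).continuousOn (fun x hx => ?_)
    fun x₁ hx₁ x₂ hx₂ hx => ?_
  · rw [interior_Icc] at hx
    obtain ⟨y, hy, rfl⟩ := exists_cosh_inv_eq hx
    exact (hasDerivAt_powSum_rpow hq hy).differentiableAt.differentiableWithinAt
  · rw [interior_Icc] at hx₁ hx₂
    obtain ⟨y₁, hy₁, rfl⟩ := exists_cosh_inv_eq hx₁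
    obtain ⟨y₂, hy₂, rfl⟩ := exists_cosh_inv_eq hx₂
    rw [inv_le_inv₀ (cosh_pos _) (cosh_pos _), cosh_le_cosh, abs_of_pos hy₁, abs_of_pos hy₂] at hx
    rw [(hasDerivAt_powSum_rpow hq hy₁).deriv, (hasDerivAt_powSum_rpow hq hy₂).deriv]
    have := antitoneOn_logSlope hq hs1 hqs3 hy₂ hy₁ hx
    have : 0 ≤ q := by linarith
    gcongr

/-- For `q > 1`, `0 < s ≤ 1`, `1 ≤ qs ≤ 3`, the function `h_{q,s}` is
monotonically nondecreasing and convex on `[0,1]`. -/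
theorem stmt13 (q s : ℝ) (hq : 1 < q) (hs0 : 0 < s) (hs1 : s ≤ 1)
    (hqs1 : 1 ≤ q * s) (hqs3 : q * s ≤ 3) :
    MonotoneOn (hqs q s) (Set.Icc 0 1) ∧
      ConvexOn ℝ (Set.Icc 0 1) (hqs q s) := by
  have hden : 0 < 1 - (2 : ℝ) ^ (s * (1 - q)) :=
    sub_pos.2 (rpow_lt_one_of_one_lt_of_neg one_lt_two (mul_neg_of_pos_of_neg hs0 (by linarith)))
  refine ⟨fun x hx y hy hxy => ?_, ?_⟩
  · exact div_le_div_of_nonneg_right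
      (sub_le_sub_left (antitoneOn_powSum_rpow hq hs0.le hx hy hxy) 1) hden.le
  · have h := ((convexOn_const (1 : ℝ) (convex_Icc 0 1)).sub
      (concaveOn_powSum_rpow hq hs0.le hs1 hqs3)).smul (inv_nonneg.2 hden.le)
    exact h.congr fun x _ => (div_eq_inv_mul _ _).symm
end

section
/- Let q ≥ 2, 0 < s ≤ 1 and 1 ≤ qs ≤ 3. Let c, c_2, …, c_n be reals in [0,1] satisfying Σ_{i=2}^n c_i² ≤ c². Then h_{q,s}(c) ≥ Σ_{i=2}^n h_{q,s}(c_i), where h_{q,s}(x) = [1 − (((1+√(1−x²))/2)^q + ((1−√(1−x²))/2)^q)^s]/(1 − 2^{s(1−q)}). (Applied with c the concurrence of an n-qubit pure state across the bipartition A_1|A_2⋯A_n and c_i the two-qubit concurrences C(ρ_{A_1 A_i}), this yields the monogamy inequality for the normalized unified (q,s)-concurrence.) -/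
open Real Set in
lemma convexOn_sinh_Ici : ConvexOn ℝ (Ici (0 : ℝ)) sinh := by
  refine MonotoneOn.convexOn_of_deriv (convex_Ici 0) continuous_sinh.continuousOn
    differentiable_sinh.differentiableOn ?_
  rw [Real.deriv_sinh, interior_Ici]
  intro x hx y hy hxy
  rw [Real.cosh_le_cosh, abs_of_pos hx, abs_of_pos hy]
  exact hxy

open Real in
lemma sinh_trapezoid {q ℓ : ℝ} (hq : 2 ≤ q) (hq3 : q ≤ 3) (hℓ : 0 ≤ ℓ) :
    (q - 1) * sinh ((3 - q) * ℓ) ≤ (3 - q) * sinh ((q - 1) * ℓ) := by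
  have hq1 : 0 < q - 1 := by linarith
  have h := convexOn_sinh_Ici.2 (Set.mem_Ici.2 le_rfl) (Set.mem_Ici.2 (mul_nonneg hq1.le hℓ))
    (show 0 ≤ 1 - (3 - q) / (q - 1) by rw [sub_nonneg, div_le_one hq1]; linarith)
    (div_nonneg (by linarith) hq1.le) (sub_add_cancel _ _)
  have e : (3 - q) / (q - 1) * ((q - 1) * ℓ) = (3 - q) * ℓ := by field_simp
  simp only [smul_eq_mul, mul_zero, sinh_zero, zero_add, e] at h
  rw [div_mul_eq_mul_div, le_div_iff₀ hq1] at h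
  linarith

open Real in
lemma sinh_mul_le_sinh {q ℓ : ℝ} (hq3 : 3 ≤ q) (hℓ : 0 ≤ ℓ) :
    sinh ℓ * (2 * (q - 1) * cosh ℓ ^ 2 - 1) ≤ sinh ((2 * q - 3) * ℓ) := by
  have hq2 : 0 < q - 2 := by linarith
  have h := convexOn_sinh_Ici.2 (Set.mem_Ici.2 hℓ)
    (show (2 * q - 3) * ℓ ∈ Set.Ici 0 from mul_nonneg (by linarith) hℓ)
    (show 0 ≤ (q - 3) / (q - 2) from div_nonneg (by linarith) hq2.le)
    (show 0 ≤ 1 / (q - 2) by positivity) (by field_simp; ring)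
  have e : (q - 3) / (q - 2) * ℓ + 1 / (q - 2) * ((2 * q - 3) * ℓ) = 3 * ℓ := by
    field_simp; ring
  simp only [smul_eq_mul, e] at h
  rw [div_mul_eq_mul_div, div_mul_eq_mul_div, ← add_div, le_div_iff₀ hq2, one_mul,
    sinh_three_mul] at h
  have h0 : 0 ≤ (q - 3) * sinh ℓ ^ 3 :=
    mul_nonneg (by linarith) (pow_nonneg (sinh_nonneg_iff.2 hℓ) 3)
  rw [cosh_sq ℓ]
  nlinarith

open Real in
/-- The inequality expressing that the logarithmic derivative of
`t ↦ (A ^ q + B ^ q) ^ (s - 1) * (A ^ (q - 1) - B ^ (q - 1)) / (A - B)`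
is nonpositive, where `A = (1 + t) / 2` and `B = (1 - t) / 2`. -/
lemma rpow_two_point_inequality {q s A B : ℝ} (hq : 2 ≤ q) (hs1 : s ≤ 1) (hqs3 : q * s ≤ 3)
    (hB : 0 < B) (hBA : B ≤ A) :
    q * (s - 1) * (A ^ (q - 1) - B ^ (q - 1)) ^ 2 * (A - B)
      + (q - 1) * (A ^ (q - 2) + B ^ (q - 2)) * (A ^ q + B ^ q) * (A - B)
      ≤ 2 * (A ^ q + B ^ q) * (A ^ (q - 1) - B ^ (q - 1)) := by
  have hA : 0 < A := hB.trans_le hBA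
  obtain ⟨α, rfl⟩ : ∃ α, A = exp α := ⟨log A, (exp_log hA).symm⟩
  obtain ⟨β, rfl⟩ : ∃ β, B = exp β := ⟨log B, (exp_log hB).symm⟩
  obtain ⟨μ, ℓ, rfl, rfl⟩ : ∃ μ ℓ, α = μ + ℓ ∧ β = μ - ℓ :=
    ⟨(α + β) / 2, (α - β) / 2, by ring, by ring⟩
  have hℓ : 0 ≤ ℓ := by linarith [exp_le_exp.1 hBA]
  have hAq : ∀ x : ℝ, exp x ^ q = exp x ^ (q - 2) * exp x ^ 2 := fun x => by
    rw [← rpow_add_natCast (exp_pos x).ne']; norm_num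
  have hAq1 : ∀ x : ℝ, exp x ^ (q - 1) = exp x ^ (q - 2) * exp x := fun x => by
    rw [← rpow_add_one (exp_pos x).ne']; ring_nf
  have ht : 0 ≤ exp (μ + ℓ) - exp (μ - ℓ) := sub_nonneg.2 hBA
  simp only [hAq, hAq1]
  have ha : exp (μ + ℓ) ^ (q - 2) = exp ((q - 2) * μ) * exp ((q - 2) * ℓ) := by
    rw [← exp_mul, ← exp_add]; ring_nf
  have hb : exp (μ - ℓ) ^ (q - 2) = exp ((q - 2) * μ) * (exp ((q - 2) * ℓ))⁻¹ := by
    rw [← exp_mul, ← exp_neg, ← exp_add]; ring_nf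
  have hA' : exp (μ + ℓ) = exp μ * exp ℓ := exp_add _ _
  have hB' : exp (μ - ℓ) = exp μ * (exp ℓ)⁻¹ := by rw [← exp_neg, ← exp_add]; ring_nf
  rw [ha, hb, hA', hB']
  rw [hA', hB'] at ht
  have hE := exp_pos μ
  have hG := exp_pos ((q - 2) * μ)
  have hu := exp_pos ℓ
  have hw := exp_pos ((q - 2) * ℓ)
  rcases le_total q 3 with hq3 | hq3
  · have h := sinh_trapezoid hq hq3 hℓ
    have e1 : exp ((3 - q) * ℓ) = exp ℓ * (exp ((q - 2) * ℓ))⁻¹ := by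
      rw [← exp_neg, ← exp_add]; ring_nf
    have e2 : exp ((q - 1) * ℓ) = exp ℓ * exp ((q - 2) * ℓ) := by
      rw [← exp_add]; ring_nf
    rw [sinh_eq, sinh_eq, exp_neg, exp_neg, e1, e2, mul_inv, mul_inv, inv_inv] at h
    generalize exp ((q - 2) * ℓ) = w at *
    generalize exp ((q - 2) * μ) = G at *
    generalize exp ℓ = u at *
    generalize exp μ = E at *
    have h1 := mul_nonneg (show 0 ≤ 2 * E * G * (G * w * (E * u) ^ 2 + G * w⁻¹ * (E * u⁻¹) ^ 2)
      by positivity) (sub_nonneg.2 h)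
    have h2 := mul_nonneg (mul_nonneg (show 0 ≤ q * (1 - s) from
      mul_nonneg (by linarith) (by linarith))
      (sq_nonneg (G * w * (E * u) - G * w⁻¹ * (E * u⁻¹)))) ht
    rw [← sub_nonneg]
    refine (add_nonneg h1 h2).trans_eq ?_
    ring
  · have h := sinh_mul_le_sinh hq3 hℓ
    have e1 : exp ((2 * q - 3) * ℓ) = exp ((q - 2) * ℓ) ^ 2 * exp ℓ := by
      rw [← exp_nat_mul, ← exp_add]; push_cast; ring_nf
    rw [sinh_eq, sinh_eq, cosh_eq, exp_neg, exp_neg, e1] at h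
    generalize exp ((q - 2) * ℓ) = w at *
    generalize exp ((q - 2) * μ) = G at *
    generalize exp ℓ = u at *
    generalize exp μ = E at *
    have h1 := mul_nonneg (show 0 ≤ 4 * E ^ 3 * G ^ 2 by positivity) (sub_nonneg.2 h)
    have h2 := mul_nonneg (mul_nonneg (show 0 ≤ 3 - q * s by linarith)
      (sq_nonneg (G * w * (E * u) - G * w⁻¹ * (E * u⁻¹)))) ht
    rw [← sub_nonneg]
    refine (add_nonneg h1 h2).trans_eq ?_
    field_simp
    ring

open Real in
lemma hasDerivAt_two_point_rpow {p t : ℝ} (h1 : 0 < 1 + t) (h2 : 0 < 1 - t) (σ : ℝ) :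
    HasDerivAt (fun t : ℝ => ((1 + t) / 2) ^ p + σ * ((1 - t) / 2) ^ p)
      (p / 2 * (((1 + t) / 2) ^ (p - 1) - σ * ((1 - t) / 2) ^ (p - 1))) t := by
  have hA : HasDerivAt (fun t : ℝ => (1 + t) / 2) (1 / 2) t :=
    ((hasDerivAt_id t).const_add 1).div_const 2
  have hB : HasDerivAt (fun t : ℝ => (1 - t) / 2) (-1 / 2) t :=
    ((hasDerivAt_id t).const_sub 1).div_const 2
  have := (hA.rpow_const (p := p) (Or.inl (by positivity))).add
    ((hB.rpow_const (p := p) (Or.inl (by positivity))).const_mul σ)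
  exact this.congr_deriv (by ring)

open Real Set in
lemma antitoneOn_two_point_quotient {q s : ℝ} (hq : 2 ≤ q) (hs1 : s ≤ 1) (hqs3 : q * s ≤ 3) :
    AntitoneOn (fun t : ℝ => (((1 + t) / 2) ^ q + ((1 - t) / 2) ^ q) ^ (s - 1)
      * (((1 + t) / 2) ^ (q - 1) - ((1 - t) / 2) ^ (q - 1)) / t) (Ioo 0 1) := by
  have key : ∀ t ∈ Ioo (0 : ℝ) 1, ∃ d ≤ 0, HasDerivAt (fun t : ℝ =>
      (((1 + t) / 2) ^ q + ((1 - t) / 2) ^ q) ^ (s - 1)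
      * (((1 + t) / 2) ^ (q - 1) - ((1 - t) / 2) ^ (q - 1)) / t) d t := by
    rintro t ⟨ht0, ht1⟩
    have h1 : 0 < 1 + t := by linarith
    have h2 : 0 < 1 - t := by linarith
    have hN := hasDerivAt_two_point_rpow (p := q) h1 h2 1
    have hK := hasDerivAt_two_point_rpow (p := q - 1) h1 h2 (-1)
    have hineq := rpow_two_point_inequality hq hs1 hqs3 (A := (1 + t) / 2) (B := (1 - t) / 2)
      (by positivity) (by linarith)
    simp only [one_mul, neg_mul, ← sub_eq_add_neg, sub_neg_eq_add] at hN hK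
    rw [show q - 1 - 1 = q - 2 by ring] at hK
    have hNpos : 0 < ((1 + t) / 2) ^ q + ((1 - t) / 2) ^ q := by positivity
    refine ⟨_, ?_, ((hN.rpow_const (p := s - 1) (Or.inl hNpos.ne')).mul hK).div
      (hasDerivAt_id t) ht0.ne'⟩
    refine div_nonpos_of_nonpos_of_nonneg ?_ (sq_nonneg _)
    dsimp only [Pi.mul_apply, id]
    rw [show s - 1 = (s - 1 - 1) + 1 by ring, rpow_add_one hNpos.ne' (s - 1 - 1),
      show s - 1 - 1 + 1 - 1 = s - 1 - 1 by ring, show s - 1 - 1 + 1 = s - 1 by ring]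
    have hP := rpow_pos_of_pos hNpos (s - 1 - 1)
    rw [show (1 + t) / 2 - (1 - t) / 2 = t by ring] at hineq
    have := mul_le_mul_of_nonneg_left hineq hP.le
    nlinarith
  refine antitoneOn_of_deriv_nonpos (convex_Ioo 0 1) ?_ ?_ ?_
  · intro t ht
    obtain ⟨d, -, hd⟩ := key t ht
    exact hd.continuousAt.continuousWithinAt
  · rw [interior_Ioo]
    intro t ht
    obtain ⟨d, -, hd⟩ := key t ht
    exact hd.differentiableAt.differentiableWithinAt
  · rw [interior_Ioo]
    intro t ht
    obtain ⟨d, h0, hd⟩ := key t ht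
    rwa [hd.deriv]

open Real Set in
lemma concaveOn_two_point_rpow_sqrt {q s : ℝ} (hq : 2 ≤ q) (hs0 : 0 < s) (hs1 : s ≤ 1)
    (hqs3 : q * s ≤ 3) :
    ConcaveOn ℝ (Icc (0 : ℝ) 1)
      (fun u => (((1 + √u) / 2) ^ q + ((1 - √u) / 2) ^ q) ^ s) := by
  have hd : ∀ u ∈ Ioo (0 : ℝ) 1,
      HasDerivAt (fun u => (((1 + √u) / 2) ^ q + ((1 - √u) / 2) ^ q) ^ s)
        (q * s / 4 * ((((1 + √u) / 2) ^ q + ((1 - √u) / 2) ^ q) ^ (s - 1)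
      * (((1 + √u) / 2) ^ (q - 1) - ((1 - √u) / 2) ^ (q - 1)) / √u)) u := by
    rintro u ⟨hu0, hu1⟩
    have ht0 : 0 < √u := sqrt_pos.2 hu0
    have ht1 : √u < 1 := by rwa [sqrt_lt' one_pos, one_pow]
    have h1 : 0 < 1 + √u := by linarith
    have h2 : 0 < 1 - √u := by linarith
    have hN := hasDerivAt_two_point_rpow (p := q) h1 h2 1
    simp only [one_mul] at hN
    have hNpos : 0 < ((1 + √u) / 2) ^ q + ((1 - √u) / 2) ^ q := by positivity
    have := (hN.rpow_const (p := s) (Or.inl hNpos.ne')).comp u (hasDerivAt_sqrt hu0.ne')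
    refine this.congr_deriv ?_
    field_simp
    ring
  refine AntitoneOn.concaveOn_of_deriv (convex_Icc 0 1) ?_ ?_ ?_
  · have hq0 : 0 ≤ q := by linarith
    refine Continuous.continuousOn ?_
    exact ((((continuous_const.add continuous_sqrt).div_const 2).rpow_const
      fun _ => Or.inr hq0).add (((continuous_const.sub continuous_sqrt).div_const 2).rpow_const
      fun _ => Or.inr hq0)).rpow_const fun _ => Or.inr hs0.le
  · rw [interior_Icc]
    exact fun u hu => (hd u hu).differentiableAt.differentiableWithinAt
  · rw [interior_Icc]
    intro u hu v hv huv
    rw [(hd u hu).deriv, (hd v hv).deriv]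
    have mem : ∀ w ∈ Ioo (0 : ℝ) 1, √w ∈ Ioo (0 : ℝ) 1 := fun w hw =>
      ⟨sqrt_pos.2 hw.1, by rw [sqrt_lt' one_pos, one_pow]; exact hw.2⟩
    exact mul_le_mul_of_nonneg_left (antitoneOn_two_point_quotient hq hs1 hqs3 (mem u hu)
      (mem v hv) (sqrt_le_sqrt huv)) (by positivity)

lemma one_sub_two_rpow_pos {q s : ℝ} (hq : 1 < q) (hs0 : 0 < s) :
    0 < 1 - (2 : ℝ) ^ (s * (1 - q)) := by
  rw [sub_pos]
  exact Real.rpow_lt_one_of_one_lt_of_neg one_lt_two (by nlinarith)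

lemma hqs_zero {q s : ℝ} (hq : 0 < q) : hqs q s 0 = 0 := by
  simp [hqs, Real.zero_rpow hq.ne']

lemma hqs_nonneg {q s x : ℝ} (hq : 1 < q) (hs0 : 0 < s) : 0 ≤ hqs q s x := by
  refine div_nonneg (sub_nonneg.2 ?_) (one_sub_two_rpow_pos hq hs0).le
  have ht0 := Real.sqrt_nonneg (1 - x ^ 2)
  have ht1 : √(1 - x ^ 2) ≤ 1 := Real.sqrt_le_one.2 (by nlinarith [sq_nonneg x])
  have h1 : 0 ≤ (1 + √(1 - x ^ 2)) / 2 := by linarith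
  have h2 : 0 ≤ (1 - √(1 - x ^ 2)) / 2 := by linarith
  refine Real.rpow_le_one (by positivity) ?_ hs0.le
  have e1 := Real.rpow_le_self_of_le_one h1 (by linarith) hq.le
  have e2 := Real.rpow_le_self_of_le_one h2 (by linarith) hq.le
  linarith

lemma hqs_le_div_mul_hqs {q s x c : ℝ} (hq : 2 ≤ q) (hs0 : 0 < s) (hs1 : s ≤ 1)
    (hqs3 : q * s ≤ 3) (hc0 : 0 < c) (hc1 : c ≤ 1) (hxc : x ^ 2 ≤ c ^ 2) :
    hqs q s x ≤ x ^ 2 / c ^ 2 * hqs q s c := by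
  have hc2 : 0 < c ^ 2 := by positivity
  have h := (concaveOn_two_point_rpow_sqrt hq hs0 hs1 hqs3).2
    (show 1 - c ^ 2 ∈ Set.Icc 0 1 from ⟨by nlinarith, by linarith⟩)
    (Set.right_mem_Icc.2 zero_le_one) (show 0 ≤ x ^ 2 / c ^ 2 by positivity)
    (sub_nonneg.2 ((div_le_one hc2).2 hxc)) (by ring)
  have e : x ^ 2 / c ^ 2 * (1 - c ^ 2) + (1 - x ^ 2 / c ^ 2) * 1 = 1 - x ^ 2 := by
    field_simp; ring
  have hq0 : q ≠ 0 := by linarith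
  simp only [smul_eq_mul, e, Real.sqrt_one, sub_self, zero_div, Real.zero_rpow hq0] at h
  norm_num at h
  unfold hqs
  rw [← mul_div_assoc]
  refine div_le_div_of_nonneg_right ?_ (one_sub_two_rpow_pos (by linarith) hs0).le
  linarith

/-- Monogamy-type inequality for `h_{q,s}`: if `Σ_i c_i² ≤ c²` with all
values in `[0,1]`, then `Σ_i h_{q,s}(c_i) ≤ h_{q,s}(c)`. -/
theorem stmt15 (q s : ℝ) (hq : 2 ≤ q) (hs0 : 0 < s) (hs1 : s ≤ 1)
    (hqs1 : 1 ≤ q * s) (hqs3 : q * s ≤ 3)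
    (n : ℕ) (c : ℝ) (cs : Fin n → ℝ)
    (hc : c ∈ Set.Icc (0 : ℝ) 1) (hcs : ∀ i, cs i ∈ Set.Icc (0 : ℝ) 1)
    (hsum : ∑ i, cs i ^ 2 ≤ c ^ 2) :
    ∑ i, hqs q s (cs i) ≤ hqs q s c := by
  have hle : ∀ i, cs i ^ 2 ≤ c ^ 2 := fun i =>
    (Finset.single_le_sum (f := fun i => cs i ^ 2) (fun j _ => sq_nonneg _)
      (Finset.mem_univ i)).trans hsum
  have hnn : 0 ≤ hqs q s c := hqs_nonneg (by linarith) hs0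
  rcases hc.1.eq_or_lt with rfl | hc0
  · have h0 : ∀ i, cs i = 0 := fun i => by
      have := hle i
      exact pow_eq_zero_iff two_ne_zero |>.1 (le_antisymm (by simpa using this) (sq_nonneg _))
    simp [h0, hqs_zero (show 0 < q by linarith)]
  · calc ∑ i, hqs q s (cs i) ≤ ∑ i, cs i ^ 2 / c ^ 2 * hqs q s c :=
          Finset.sum_le_sum fun i _ => hqs_le_div_mul_hqs hq hs0 hs1 hqs3 hc0 hc.2 (hle i)
      _ = (∑ i, cs i ^ 2) / c ^ 2 * hqs q s c := by rw [← Finset.sum_mul, Finset.sum_div]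
      _ ≤ 1 * hqs q s c :=
          mul_le_mul_of_nonneg_right ((div_le_one (by positivity)).2 hsum) hnn
      _ = hqs q s c := one_mul _
end

section
/- Let q > 1 be real and define f(x) = (1−q)x^{2q} + q·x^{2q−1} − 2q·x − 1 for x ≥ 1. Then f is nonincreasing on [1, ∞), and f(x) ≤ f(1) = −2q < 0 for all x ≥ 1. -/
/-- A weighted AM-GM inequality, equivalent to Bernoulli's inequality at `x⁻¹`. -/
theorem mul_rpow_sub_one_le {p x : ℝ} (hp : 1 ≤ p) (hx : 0 < x) :
    p * x ^ (p - 1) ≤ (p - 1) * x ^ p + 1 := by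
  have hb := one_add_mul_self_le_rpow_one_add (s := x⁻¹ - 1)
    (by linarith [inv_pos.mpr hx]) hp
  rw [add_sub_cancel, Real.inv_rpow hx.le] at hb
  have hpos : 0 < x ^ p := Real.rpow_pos_of_pos hx p
  have h := mul_le_mul_of_nonneg_left hb hpos.le
  rw [mul_inv_cancel₀ hpos.ne'] at h
  rw [Real.rpow_sub_one hx.ne', div_eq_mul_inv]
  linarith

/-- The auxiliary function `f(x) = (1-q)x^{2q} + q x^{2q-1} - 2qx - 1` is
nonincreasing on `[1, ∞)` and bounded above by `f(1) = -2q < 0` there. -/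
theorem stmt18 (q : ℝ) (hq : 1 < q) :
    let f : ℝ → ℝ := fun x =>
      (1 - q) * x ^ (2 * q) + q * x ^ (2 * q - 1) - 2 * q * x - 1
    AntitoneOn f (Set.Ici 1) ∧ (∀ x, 1 ≤ x → f x ≤ -(2 * q)) ∧
      f 1 = -(2 * q) ∧ -(2 * q) < 0 := by
  intro f
  have hderiv : ∀ x : ℝ, 0 < x → HasDerivAt f
      ((1 - q) * (2 * q * x ^ (2 * q - 1)) + q * ((2 * q - 1) * x ^ (2 * q - 1 - 1))
        - 2 * q * 1) x := fun x hx =>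
    ((((Real.hasDerivAt_rpow_const (Or.inl hx.ne')).const_mul (1 - q)).add
      ((Real.hasDerivAt_rpow_const (Or.inl hx.ne')).const_mul q)).sub
        ((hasDerivAt_id x).const_mul (2 * q))).sub_const 1
  have hanti : AntitoneOn f (Set.Ici 1) := by
    refine antitoneOn_of_deriv_nonpos (convex_Ici 1)
      (fun x hx => (hderiv x (zero_lt_one.trans_le hx)).continuousAt.continuousWithinAt)
      (fun x hx => ?_) (fun x hx => ?_) <;> rw [interior_Ici] at hx
    · exact (hderiv x (zero_lt_one.trans hx)).differentiableAt.differentiableWithinAt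
    · have hx0 : 0 < x := zero_lt_one.trans hx
      rw [(hderiv x hx0).deriv]
      have h := mul_le_mul_of_nonneg_left
        (mul_rpow_sub_one_le (p := 2 * q - 1) (by linarith) hx0) (by linarith : 0 ≤ q)
      linarith
  have hone : f 1 = -(2 * q) := by
    simp only [f, Real.one_rpow]
    ring
  exact ⟨hanti, fun x hx => hone ▸ hanti Set.self_mem_Ici hx hx, hone, by linarith⟩
end
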